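/- arXiv:1209.2920 — 2 statements merged into one kernel-verified Lean document; each statement's English description precedes it below -/
import Mathlib

section
/- Let α be a real number. The inequality α·(Q(a,b)/3 + 2·A(a,b)/3) + (1-α)·Q(a,b)^{1/3}·A(a,b)^{2/3} < M(a,b) holds for all a, b > 0 with a ≠ b if and only if α ≤ α₀, where α₀ = (3 - 3·2^{1/6}·log(1+√2)) / ((2 + √2 - 3·2^{1/6})·log(1+√2)). -/
noncomputable def M (a b : ℝ) : ℝ := (a - b) / (2 * Real.arsinh ((a - b) / (a + b)))
noncomputable def A (a b : ℝ) : ℝ := (a + b) / 2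
noncomputable def Q (a b : ℝ) : ℝ := Real.sqrt ((a ^ 2 + b ^ 2) / 2)

/-- The sixth root of `1 + x ^ 2`. -/
noncomputable def sixthRoot (x : ℝ) : ℝ := (1 + x ^ 2) ^ ((1 : ℝ) / 6)

/-- The convex combination of `(u ^ 3 + 2) / 3` and `u` with weight `α`. -/
noncomputable def mix (α u : ℝ) : ℝ := α * (u ^ 3 / 3 + 2 / 3) + (1 - α) * u

/-- The difference whose sign decides the comparison of the means. -/
noncomputable def gap (α x : ℝ) : ℝ := x / mix α (sixthRoot x) - Real.arsinh x

/-- The polynomial factor that carries the sign of the derivative of `gap α`. -/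
noncomputable def slopePoly (α u : ℝ) : ℝ :=
  -α ^ 2 * u ^ 6 - 2 * α ^ 2 * u ^ 5 + (6 - 12 * α + 3 * α ^ 2) * u ^ 4
    + (12 - 18 * α + 4 * α ^ 2) * u ^ 3 + (9 - 6 * α - 4 * α ^ 2) * u ^ 2
    + (6 - 6 * α) * u + (3 - 3 * α)

lemma sixthRoot_pos (x : ℝ) : 0 < sixthRoot x := by
  unfold sixthRoot; positivity

lemma sixthRoot_pow_six (x : ℝ) : sixthRoot x ^ 6 = 1 + x ^ 2 := by
  unfold sixthRoot
  rw [← Real.rpow_natCast, ← Real.rpow_mul (by positivity)]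
  norm_num

lemma sixthRoot_pow_three (x : ℝ) : sixthRoot x ^ 3 = √(1 + x ^ 2) := by
  rw [eq_comm, Real.sqrt_eq_iff_mul_self_eq (by positivity) (pow_pos (sixthRoot_pos x) 3).le,
    ← sixthRoot_pow_six x]
  ring

lemma sixthRoot_zero : sixthRoot 0 = 1 := by simp [sixthRoot]

lemma sixthRoot_one : sixthRoot 1 = (2 : ℝ) ^ ((1 : ℝ) / 6) := by
  unfold sixthRoot; norm_num

lemma sixthRoot_lt {x y : ℝ} (hx : 0 ≤ x) (hxy : x < y) : sixthRoot x < sixthRoot y := by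
  unfold sixthRoot
  apply Real.rpow_lt_rpow (by positivity) _ (by norm_num)
  nlinarith

lemma one_lt_sixthRoot {x : ℝ} (hx : 0 < x) : 1 < sixthRoot x := by
  simpa [sixthRoot_zero] using sixthRoot_lt le_rfl hx

lemma hasDerivAt_sixthRoot (x : ℝ) :
    HasDerivAt sixthRoot (x / (3 * sixthRoot x ^ 5)) x := by
  have hbase : (0 : ℝ) < 1 + x ^ 2 := by positivity
  have h := (((hasDerivAt_id x).pow 2).const_add 1).rpow_const (p := (1 : ℝ) / 6)
    (Or.inl hbase.ne')
  refine h.congr_deriv ?_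
  have hu : sixthRoot x ^ 5 = (1 + x ^ 2) * (sixthRoot x)⁻¹ := by
    rw [← sixthRoot_pow_six x]
    field_simp [(sixthRoot_pos x).ne']
  simp only [id, Pi.pow_apply]
  rw [hu, Real.rpow_sub hbase, Real.rpow_one]
  change _ * (sixthRoot x / _) = _
  have := (sixthRoot_pos x).ne'
  field_simp
  norm_num
  ring

lemma continuous_sixthRoot : Continuous sixthRoot :=
  continuous_iff_continuousAt.2 fun x => (hasDerivAt_sixthRoot x).continuousAt

lemma mix_pos {α u : ℝ} (h0 : 0 ≤ α) (h1 : α < 1) (hu : 0 < u) : 0 < mix α u := by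
  have : 0 < 1 - α := by linarith
  unfold mix; positivity

lemma mix_le_mix {α β u : ℝ} (h : α ≤ β) (hu : 0 ≤ u) : mix α u ≤ mix β u := by
  unfold mix
  nlinarith [mul_nonneg (sub_nonneg.2 h) (mul_nonneg (sq_nonneg (u - 1))
    (by linarith : (0 : ℝ) ≤ u + 2))]

lemma hasDerivAt_gap {α : ℝ} (h0 : 0 ≤ α) (h1 : α < 1) (x : ℝ) :
    HasDerivAt (gap α) ((sixthRoot x - 1) ^ 2 * slopePoly α (sixthRoot x) /
      (9 * sixthRoot x ^ 5 * mix α (sixthRoot x) ^ 2)) x := by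
  have hu := sixthRoot_pos x
  have hm := mix_pos h0 h1 hu
  have hmix : HasDerivAt (fun y => mix α (sixthRoot y))
      ((α * sixthRoot x ^ 2 + (1 - α)) * (x / (3 * sixthRoot x ^ 5))) x := by
    have hd := hasDerivAt_sixthRoot x
    refine (((((hd.pow 3).div_const 3).add_const (2 / 3)).const_mul α).add
      (hd.const_mul (1 - α))).congr_deriv ?_
    norm_num
    ring
  refine (((hasDerivAt_id x).div hmix hm.ne').sub (Real.hasDerivAt_arsinh x)).congr_deriv ?_
  rw [← sixthRoot_pow_three x]
  have hx : x ^ 2 = sixthRoot x ^ 6 - 1 := by rw [sixthRoot_pow_six]; ring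
  simp only [id]
  generalize sixthRoot x = u at *
  field_simp
  rw [hx]
  unfold mix slopePoly
  ring

lemma continuous_gap {α : ℝ} (h0 : 0 ≤ α) (h1 : α < 1) : Continuous (gap α) :=
  continuous_iff_continuousAt.2 fun x => (hasDerivAt_gap h0 h1 x).continuousAt

/-- The coefficients of `slopePoly α` change sign exactly once. -/
lemma slopePoly_sign {α v w : ℝ} (h0 : 3 / 5 ≤ α) (h1 : α ≤ 4 / 5) (hv : 0 < v) (hvw : v < w) :
    v ^ 3 * slopePoly α w < w ^ 3 * slopePoly α v := by
  have hw : 0 < w := hv.trans hvw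
  have c4 : 0 ≤ -(6 - 12 * α + 3 * α ^ 2) := by nlinarith
  have c3 : 0 < α ^ 2 := by positivity
  have c2 : 0 ≤ 9 - 6 * α - 4 * α ^ 2 := by nlinarith
  have c1 : 0 ≤ 6 - 6 * α := by linarith
  have hfac : w ^ 3 * slopePoly α v - v ^ 3 * slopePoly α w = (w - v) *
      (α ^ 2 * (v ^ 3 * w ^ 3 * (w ^ 2 + w * v + v ^ 2))
        + 2 * α ^ 2 * (v ^ 3 * w ^ 3 * (w + v))
        + -(6 - 12 * α + 3 * α ^ 2) * (v ^ 3 * w ^ 3)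
        + (9 - 6 * α - 4 * α ^ 2) * (v ^ 2 * w ^ 2)
        + (6 - 6 * α) * (v * w * (w + v))
        + (6 - 6 * α) / 2 * (w ^ 2 + w * v + v ^ 2)) := by
    unfold slopePoly; ring
  have : 0 < w - v := sub_pos.2 hvw
  have : 0 < w ^ 3 * slopePoly α v - v ^ 3 * slopePoly α w := by
    rw [hfac]; positivity
  linarith

lemma gap_pos_of_slopePoly_nonneg {α x : ℝ} (h0 : 3 / 5 ≤ α) (h1 : α ≤ 4 / 5) (hx : 0 < x)
    (hP : 0 ≤ slopePoly α (sixthRoot x)) : 0 < gap α x := by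
  have hα0 : 0 ≤ α := by linarith
  have hα1 : α < 1 := by linarith
  have hmono : StrictMonoOn (gap α) (Set.Icc 0 x) := by
    apply strictMonoOn_of_deriv_pos (convex_Icc 0 x) (continuous_gap hα0 hα1).continuousOn
    intro y hy
    rw [interior_Icc] at hy
    have hu := sixthRoot_pos y
    have hm := mix_pos hα0 hα1 hu
    have hu1 : 0 < sixthRoot y - 1 := sub_pos.2 (one_lt_sixthRoot hy.1)
    have hs := slopePoly_sign h0 h1 hu (sixthRoot_lt hy.1.le hy.2)
    have hPy : 0 < slopePoly α (sixthRoot y) :=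
      pos_of_mul_pos_right ((mul_nonneg (pow_pos hu 3).le hP).trans_lt hs)
        (pow_pos (sixthRoot_pos x) 3).le
    rw [(hasDerivAt_gap hα0 hα1 y).deriv]
    positivity
  simpa [gap] using hmono (Set.left_mem_Icc.2 hx.le) (Set.right_mem_Icc.2 hx.le) hx

lemma gap_lt_of_slopePoly_nonpos {α x y : ℝ} (h0 : 3 / 5 ≤ α) (h1 : α ≤ 4 / 5) (hx : 0 ≤ x)
    (hxy : x < y) (hP : slopePoly α (sixthRoot x) ≤ 0) : gap α y < gap α x := by
  have hα0 : 0 ≤ α := by linarith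
  have hα1 : α < 1 := by linarith
  have hanti : StrictAntiOn (gap α) (Set.Icc x y) := by
    apply strictAntiOn_of_deriv_neg (convex_Icc x y) (continuous_gap hα0 hα1).continuousOn
    intro z hz
    rw [interior_Icc] at hz
    have hu := sixthRoot_pos z
    have hm := mix_pos hα0 hα1 hu
    have hu1 : 0 < sixthRoot z - 1 := sub_pos.2 (one_lt_sixthRoot (hx.trans_lt hz.1))
    have hs := slopePoly_sign h0 h1 (sixthRoot_pos x) (sixthRoot_lt hx hz.1)
    have hPz : slopePoly α (sixthRoot z) < 0 :=
      neg_of_mul_neg_right (hs.trans_le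
        (mul_nonpos_of_nonneg_of_nonpos (pow_pos hu 3).le hP)) (pow_pos (sixthRoot_pos x) 3).le
    rw [(hasDerivAt_gap hα0 hα1 z).deriv]
    exact div_neg_of_neg_of_pos (mul_neg_of_pos_of_neg (by positivity) hPz) (by positivity)
  exact hanti (Set.left_mem_Icc.2 hxy.le) (Set.right_mem_Icc.2 hxy.le) hxy

lemma gap_four_fifths_neg : gap (4 / 5) 1 < 0 := by
  have h := gap_lt_of_slopePoly_nonpos (α := 4 / 5) (x := 0) (y := 1) (by norm_num) le_rfl le_rfl
    one_pos (by rw [sixthRoot_zero]; norm_num [slopePoly])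
  simpa [gap] using h

lemma gap_three_fifths_pos : 0 < gap (3 / 5) 1 := by
  apply gap_pos_of_slopePoly_nonneg le_rfl (by norm_num) one_pos
  have h6 := sixthRoot_pow_six 1
  have hu := one_lt_sixthRoot one_pos
  generalize sixthRoot 1 = u at *
  have hu2 : u ≤ 9 / 8 := by
    by_contra! h
    have := pow_lt_pow_left₀ h (by norm_num) (n := 6) (by norm_num)
    norm_num at this h6
    linarith
  have hpow : ∀ n : ℕ, 1 ≤ u ^ n ∧ u ^ n ≤ (9 / 8) ^ n := fun n =>
    ⟨one_le_pow₀ hu.le, pow_le_pow_left₀ (by linarith) hu2 n⟩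
  unfold slopePoly
  linarith [(hpow 2).1, (hpow 3).1, (hpow 4).2, (hpow 5).2]

/-- The largest admissible weight. -/
noncomputable def optimalWeight : ℝ :=
  (3 - 3 * (2 : ℝ) ^ ((1 : ℝ)/6) * Real.log (1 + Real.sqrt 2)) /
    ((2 + Real.sqrt 2 - 3 * (2 : ℝ) ^ ((1 : ℝ)/6)) * Real.log (1 + Real.sqrt 2))

lemma le_optimalWeight_iff (α : ℝ) :
    α ≤ optimalWeight ↔ mix α (sixthRoot 1) ≤ 1 / Real.arsinh 1 := by
  have hL : Real.log (1 + √2) = Real.arsinh 1 := by norm_num [Real.arsinh]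
  have hs : √2 = sixthRoot 1 ^ 3 := by rw [sixthRoot_pow_three]; norm_num
  have hpos : 0 < Real.arsinh 1 := Real.arsinh_pos_iff.2 one_pos
  have hu := one_lt_sixthRoot one_pos
  unfold optimalWeight
  rw [hL, ← sixthRoot_one, hs]
  generalize sixthRoot 1 = u at *
  have hden : 0 < 2 + u ^ 3 - 3 * u := by
    have : 0 < (u - 1) ^ 2 * (u + 2) := by
      have := sub_pos.2 hu
      positivity
    linarith
  rw [le_div_iff₀ (by positivity), le_div_iff₀ hpos, mix]
  constructor <;> intro h <;> linarith

lemma le_optimalWeight_iff_gap_nonneg {α : ℝ} (h0 : 0 ≤ α) (h1 : α < 1) :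
    α ≤ optimalWeight ↔ 0 ≤ gap α 1 := by
  rw [le_optimalWeight_iff, gap, sub_nonneg,
    le_div_comm₀ (mix_pos h0 h1 (sixthRoot_pos 1)) (Real.arsinh_pos_iff.2 one_pos)]

lemma optimalWeight_bounds : 3 / 5 ≤ optimalWeight ∧ optimalWeight ≤ 4 / 5 := by
  refine ⟨(le_optimalWeight_iff_gap_nonneg (by norm_num) (by norm_num)).2
    gap_three_fifths_pos.le, ?_⟩
  by_contra! h
  exact absurd ((le_optimalWeight_iff_gap_nonneg (by norm_num) (by norm_num)).1 h.le)
    (not_le.2 gap_four_fifths_neg)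

lemma gap_optimalWeight_pos {x : ℝ} (hx : 0 < x) (hx1 : x < 1) : 0 < gap optimalWeight x := by
  obtain ⟨h0, h1⟩ := optimalWeight_bounds
  rcases le_total 0 (slopePoly optimalWeight (sixthRoot x)) with hP | hP
  · exact gap_pos_of_slopePoly_nonneg h0 h1 hx hP
  · exact ((le_optimalWeight_iff_gap_nonneg (by linarith) (by linarith)).1 le_rfl).trans_lt
      (gap_lt_of_slopePoly_nonpos h0 h1 hx.le hx1 hP)

lemma mix_lt_of_le_optimalWeight {α x : ℝ} (hα : α ≤ optimalWeight) (hx : 0 < x) (hx1 : x < 1) :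
    mix α (sixthRoot x) < x / Real.arsinh x := by
  obtain ⟨h0, h1⟩ := optimalWeight_bounds
  have hm := mix_pos (α := optimalWeight) (by linarith) (by linarith) (sixthRoot_pos x)
  have hg := sub_pos.1 (gap_optimalWeight_pos hx hx1)
  refine (mix_le_mix hα (sixthRoot_pos x).le).trans_lt ?_
  rwa [lt_div_comm₀ hm (Real.arsinh_pos_iff.2 hx)]

lemma le_optimalWeight_of_forall_mix_lt {α : ℝ}
    (h : ∀ x : ℝ, 0 < x → x < 1 → mix α (sixthRoot x) < x / Real.arsinh x) :
    α ≤ optimalWeight := by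
  rw [le_optimalWeight_iff]
  have hl : ContinuousAt (fun x => mix α (sixthRoot x)) 1 := by
    have := continuous_sixthRoot
    unfold mix
    fun_prop
  have hr : ContinuousAt (fun x => x / Real.arsinh x) 1 :=
    continuousAt_id.div Real.continuous_arsinh.continuousAt (Real.arsinh_pos_iff.2 one_pos).ne'
  refine le_of_tendsto_of_tendsto (hl.continuousWithinAt (s := Set.Iio 1))
    (hr.continuousWithinAt (s := Set.Iio 1)) ?_
  filter_upwards [Ioo_mem_nhdsLT (zero_lt_one (α := ℝ))] with x hx
  exact (h x hx.1 hx.2).le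

lemma M_comm (a b : ℝ) : M a b = M b a := by
  unfold M
  rw [show (b - a) / (b + a) = -((a - b) / (a + b)) by rw [add_comm b a]; ring,
    Real.arsinh_neg, ← neg_sub a b, mul_neg, neg_div_neg_eq]

lemma A_comm (a b : ℝ) : A a b = A b a := by unfold A; ring

lemma Q_comm (a b : ℝ) : Q a b = Q b a := by unfold Q; rw [add_comm]

lemma M_eq {a b : ℝ} (ha : 0 < a) (hb : 0 < b) :
    M a b = A a b * ((a - b) / (a + b) / Real.arsinh ((a - b) / (a + b))) := by
  unfold M A
  field_simp

lemma Q_eq {a b : ℝ} (ha : 0 < a) (hb : 0 < b) :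
    Q a b = A a b * sixthRoot ((a - b) / (a + b)) ^ 3 := by
  have hA : 0 ≤ A a b := by unfold A; positivity
  rw [sixthRoot_pow_three, Q, ← Real.sqrt_sq hA, ← Real.sqrt_mul (sq_nonneg _)]
  congr 1
  unfold A
  field_simp
  ring

lemma weighted_means_eq (α : ℝ) {a b : ℝ} (ha : 0 < a) (hb : 0 < b) :
    α * (Q a b / 3 + 2 * A a b / 3) +
        (1 - α) * (Q a b ^ ((1 : ℝ)/3) * A a b ^ ((2 : ℝ)/3)) =
      A a b * mix α (sixthRoot ((a - b) / (a + b))) := by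
  have hA : 0 < A a b := by unfold A; positivity
  have hu := sixthRoot_pos ((a - b) / (a + b))
  rw [Q_eq ha hb]
  generalize sixthRoot ((a - b) / (a + b)) = u at *
  have hgeom : (A a b * u ^ 3) ^ ((1 : ℝ)/3) * A a b ^ ((2 : ℝ)/3) = A a b * u := by
    rw [Real.mul_rpow hA.le (by positivity), mul_right_comm, ← Real.rpow_add hA,
      ← Real.rpow_natCast, ← Real.rpow_mul hu.le]
    norm_num
  rw [hgeom, mix]
  ring

theorem stmt_2 (α : ℝ) :
    (∀ a b : ℝ, 0 < a → 0 < b → a ≠ b →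
      α * (Q a b / 3 + 2 * A a b / 3) +
        (1 - α) * (Q a b ^ ((1 : ℝ)/3) * A a b ^ ((2 : ℝ)/3)) < M a b) ↔
    α ≤ (3 - 3 * (2 : ℝ) ^ ((1 : ℝ)/6) * Real.log (1 + Real.sqrt 2)) /
      ((2 + Real.sqrt 2 - 3 * (2 : ℝ) ^ ((1 : ℝ)/6)) * Real.log (1 + Real.sqrt 2)) := by
  change _ ↔ α ≤ optimalWeight
  constructor
  · intro h
    refine le_optimalWeight_of_forall_mix_lt fun x hx hx1 => ?_
    have ha : 0 < 1 + x := by linarith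
    have hb : 0 < 1 - x := by linarith
    have hlt := h (1 + x) (1 - x) ha hb (by linarith)
    have hA : A (1 + x) (1 - x) = 1 := by unfold A; ring
    rw [weighted_means_eq α ha hb, M_eq ha hb, hA, one_mul, one_mul,
      show (1 + x - (1 - x)) / (1 + x + (1 - x)) = x by ring] at hlt
    exact hlt
  · intro hα a b ha hb hab
    wlog hba : b < a generalizing a b
    · rw [Q_comm, A_comm, M_comm]
      exact this b a hb ha hab.symm (lt_of_le_of_ne (not_lt.1 hba) hab)
    rw [weighted_means_eq α ha hb, M_eq ha hb]
    refine mul_lt_mul_of_pos_left (mix_lt_of_le_optimalWeight hα ?_ ?_) (by unfold A; positivity)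
    · exact div_pos (sub_pos.2 hba) (by positivity)
    · rw [div_lt_one (by positivity)]; linarith
end

section
/- For all t in the open interval (1, 2^{1/6}), arsinh(√(t⁶-1)) - 6·√(t⁶-1)/((8/25)·t⁶ + 6·(17/25)·t + 8/5) > 0. -/
theorem derivative_numerator_pos {t : ℝ} (ht : 1 < t) :
    0 < 3 * t ^ 2 * ((8/25) * t ^ 6 + 6 * (17/25) * t + 8/5) ^ 2
      - 18 * t ^ 5 * ((8/25) * t ^ 6 + 6 * (17/25) * t + 8/5)
      + 6 * (t ^ 6 - 1) * ((8/25) * (6 * t ^ 5) + 6 * (17/25)) := by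
  obtain ⟨u, rfl⟩ : ∃ u, t = 1 + u := ⟨t - 1, by ring⟩
  have hu : 0 < u := by linarith
  ring_nf
  positivity

theorem hasDerivAt_arsinh_sub_div {t : ℝ} (ht : 1 < t) :
    HasDerivAt (fun x : ℝ => Real.arsinh (Real.sqrt (x ^ 6 - 1)) -
      6 * Real.sqrt (x ^ 6 - 1) / ((8/25) * x ^ 6 + 6 * (17/25) * x + 8/5))
      ((3 * t ^ 2 * ((8/25) * t ^ 6 + 6 * (17/25) * t + 8/5) ^ 2
        - 18 * t ^ 5 * ((8/25) * t ^ 6 + 6 * (17/25) * t + 8/5)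
        + 6 * (t ^ 6 - 1) * ((8/25) * (6 * t ^ 5) + 6 * (17/25))) /
        (Real.sqrt (t ^ 6 - 1) * ((8/25) * t ^ 6 + 6 * (17/25) * t + 8/5) ^ 2)) t := by
  have h0 : 0 < t := by linarith
  have h6 : 0 < t ^ 6 - 1 := sub_pos.2 (one_lt_pow₀ ht (by norm_num))
  have hD : 0 < (8/25) * t ^ 6 + 6 * (17/25) * t + 8/5 := by positivity
  have hs : HasDerivAt (fun x : ℝ => Real.sqrt (x ^ 6 - 1))
      (6 * t ^ 5 / (2 * Real.sqrt (t ^ 6 - 1))) t := by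
    simpa using ((hasDerivAt_pow 6 t).sub_const 1).sqrt h6.ne'
  have hd : HasDerivAt (fun x : ℝ => (8/25) * x ^ 6 + 6 * (17/25) * x + 8/5)
      ((8/25) * (6 * t ^ 5) + 6 * (17/25)) t := by
    simpa using (((hasDerivAt_pow 6 t).const_mul (8/25 : ℝ)).add
      ((hasDerivAt_id t).const_mul (6 * (17/25) : ℝ))).add_const (8/5 : ℝ)
  have hc : Real.sqrt (1 + Real.sqrt (t ^ 6 - 1) ^ 2) = t ^ 3 := by
    rw [Real.sq_sqrt h6.le, show 1 + (t ^ 6 - 1) = (t ^ 3) ^ 2 by ring,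
      Real.sqrt_sq (by positivity)]
  have key := hs.arsinh.sub ((hs.const_mul 6).div hd hD.ne')
  rw [hc] at key
  refine key.congr_deriv ?_
  have hspos : 0 < Real.sqrt (t ^ 6 - 1) := Real.sqrt_pos.2 h6
  have hsq : Real.sqrt (t ^ 6 - 1) ^ 2 = t ^ 6 - 1 := Real.sq_sqrt h6.le
  rw [← hsq]
  generalize Real.sqrt (t ^ 6 - 1) = s at hspos
  generalize (8/25) * t ^ 6 + 6 * (17/25) * t + 8/5 = D at hD
  rw [Real.sqrt_sq hspos.le, smul_eq_mul]
  field_simp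
  ring

theorem strictMonoOn_arsinh_sub_div :
    StrictMonoOn (fun x : ℝ => Real.arsinh (Real.sqrt (x ^ 6 - 1)) -
      6 * Real.sqrt (x ^ 6 - 1) / ((8/25) * x ^ 6 + 6 * (17/25) * x + 8/5)) (Set.Ici 1) := by
  refine strictMonoOn_of_deriv_pos (convex_Ici 1) ?_ fun t ht => ?_
  · refine ContinuousOn.sub (Real.continuous_arsinh.comp (by fun_prop)).continuousOn
      (ContinuousOn.div (by fun_prop) (by fun_prop) fun t ht => ?_)
    have h0 : (0 : ℝ) < t := zero_lt_one.trans_le ht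
    positivity
  · rw [interior_Ici, Set.mem_Ioi] at ht
    rw [(hasDerivAt_arsinh_sub_div ht).deriv]
    have h0 : 0 < t := by linarith
    have h6 : 0 < t ^ 6 - 1 := sub_pos.2 (one_lt_pow₀ ht (by norm_num))
    exact div_pos (derivative_numerator_pos ht) (by positivity)

theorem stmt_10 (t : ℝ) (ht : t ∈ Set.Ioo 1 ((2 : ℝ) ^ ((1 : ℝ)/6))) :
    Real.arsinh (Real.sqrt (t ^ 6 - 1)) -
      6 * Real.sqrt (t ^ 6 - 1) / ((8/25) * t ^ 6 + 6 * (17/25) * t + 8/5) > 0 := by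
  simpa using strictMonoOn_arsinh_sub_div Set.self_mem_Ici (Set.mem_Ici.2 ht.1.le) ht.1
end
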